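/- Let 𝔽 ∈ {ℝ, ℂ}, let k, m, n be positive integers with k ≤ n, and let r > 0 and 0 < L ≤ U be real numbers with r > 2·(U/L)². Suppose A ∈ 𝔽^{m×n} satisfies the phaseless bi-Lipschitz condition with constants L, U on the set X := {z ∈ 𝔽^n : ‖z‖₀ ≤ (r+4)k}. Set t := 1 − (U/L)·(2/r)^{1/2}, C₁ := 2·(U/L)·(r^{−1/2}+1)·(2+r)^{1/2}/t + 2, D₁ := (1/L)·2·(2+r)^{1/2}/t, C₂ := (U/L)·(r^{−1/2}+1)·(1 + (r/2)^{−1/2})/t + r^{−1/2} + 1, and D₂ := (1/L)·2·(1 + (r/2)^{−1/2})/t. Then for every x ∈ 𝔽^n, every η ≥ 0, every e ∈ ℝ^m with ‖e‖₂ ≤ η, and every x♯ ∈ 𝔽^n satisfying both ‖|A x♯| − (|A x| + e)‖₂ ≤ η and ‖x♯‖₁ ≤ ‖x‖₁ (in particular, any minimizer of ‖z‖₁ over {z ∈ 𝔽^n : ‖|Az| − (|Ax| + e)‖₂ ≤ η}), one has dist₁(x♯, x) ≤ C₁·σ_k(x)₁ + D₁·√k·η and dist(x♯, x) ≤ C₂·σ_k(x)₁/√k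 + D₂·η. -/

import Mathlib

open MeasureTheory ProbabilityTheory Real Finset

/-- The `ℓ_q` (quasi-)norm `(∑ i, ‖x i‖^q)^{1/q}` of a vector with entries in `𝕜 ∈ {ℝ, ℂ}`. -/
noncomputable def lpNorm {ι : Type*} [Fintype ι] {𝕜 : Type*} [RCLike 𝕜] (q : ℝ) (x : ι → 𝕜) : ℝ :=
  (∑ i, ‖x i‖ ^ q) ^ (1 / q)

open Classical in
/-- The number of nonzero entries of a vector. -/
noncomputable def l0Norm {ι : Type*} [Fintype ι] {𝕜 : Type*} [RCLike 𝕜] (x : ι → 𝕜) : ℕ :=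
  (Finset.univ.filter fun i => x i ≠ 0).card

/-- The phase distance `dist_q(x,y) = inf_{|c|=1} ‖x - c • y‖_q`. -/
noncomputable def phaseDist {ι : Type*} [Fintype ι] {𝕜 : Type*} [RCLike 𝕜] (q : ℝ)
    (x y : ι → 𝕜) : ℝ :=
  sInf {d | ∃ c : 𝕜, ‖c‖ = 1 ∧ d = lpNorm q (fun i => x i - c * y i)}

/-- The best `k`-term approximation error `σ_k(x)_q = inf {‖x - z‖_q : ‖z‖₀ ≤ k}`. -/
noncomputable def sigmaK {ι : Type*} [Fintype ι] {𝕜 : Type*} [RCLike 𝕜] (k : ℕ) (q : ℝ)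
    (x : ι → 𝕜) : ℝ :=
  sInf {d | ∃ z : ι → 𝕜, l0Norm z ≤ k ∧ d = lpNorm q (fun i => x i - z i)}

/-- The entrywise modulus `|Ax|` of the matrix-vector product `Ax`. -/
noncomputable def absMv {m n : ℕ} {𝕜 : Type*} [RCLike 𝕜] (A : Fin m → Fin n → 𝕜)
    (x : Fin n → 𝕜) : Fin m → ℝ :=
  fun i => ‖∑ j, A i j * x j‖

/-- `A` satisfies the phaseless bi-Lipschitz condition on `X` with constants `L, U`:
`L·dist(x,y) ≤ ‖|Ax| - |Ay|‖₂ ≤ U·dist(x,y)` for all `x, y ∈ X`. -/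
def PhaselessBiLip {m n : ℕ} {𝕜 : Type*} [RCLike 𝕜] (A : Fin m → Fin n → 𝕜)
    (X : Set (Fin n → 𝕜)) (L U : ℝ) : Prop :=
  ∀ x ∈ X, ∀ y ∈ X,
    L * phaseDist 2 x y ≤ lpNorm 2 (fun i => absMv A x i - absMv A y i) ∧
    lpNorm 2 (fun i => absMv A x i - absMv A y i) ≤ U * phaseDist 2 x y

/-- Every value outside a set of `a` largest values is at most the average over that set. -/
lemma le_sum_div_of_forall_le {ι : Type*} (g : ι → ℝ) {B : Finset ι} {a : ℕ} (ha : 0 < a) (hBa : #B = a)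
    {y : ℝ} (hB : ∀ i ∈ B, y ≤ g i) : y ≤ (∑ i ∈ B, g i) / a := by
  rw [le_div_iff₀ (by exact_mod_cast ha)]
  have := Finset.card_nsmul_le_sum B g y hB
  rw [hBa, nsmul_eq_mul] at this
  linarith

section Blocks

variable {ι : Type*} [DecidableEq ι]

/-- A finite set contains a subset of prescribed size on which `g` takes its largest values. -/
lemma exists_subset_card_eq_forall_le (g : ι → ℝ) (s : Finset ι) (a : ℕ) (ha : a ≤ #s) :
    ∃ B ⊆ s, #B = a ∧ ∀ i ∈ B, ∀ j ∈ s \ B, g j ≤ g i := by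
  induction a with
  | zero => exact ⟨∅, by simp, by simp, by simp⟩
  | succ a ih =>
    obtain ⟨B, hBs, hBa, hB⟩ := ih (by omega)
    have hne : (s \ B).Nonempty := by
      rw [← Finset.card_pos, Finset.card_sdiff_of_subset hBs]
      omega
    obtain ⟨b, hb, hmax⟩ := Finset.exists_max_image (s \ B) g hne
    have hb' := Finset.mem_sdiff.1 hb
    refine ⟨insert b B, Finset.insert_subset hb'.1 hBs, ?_, ?_⟩
    · rw [Finset.card_insert_of_notMem hb'.2, hBa]
    · intro i hi j hj
      simp only [Finset.mem_sdiff, Finset.mem_insert, not_or] at hj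
      have hj' : j ∈ s \ B := Finset.mem_sdiff.2 ⟨hj.1, hj.2.2⟩
      rcases Finset.mem_insert.1 hi with rfl | hi
      · exact hmax j hj'
      · exact hB i hi j hj'

/-- Block decomposition: a subadditive set function controlled on small sets by the maximum of `g`
is controlled on every set by the maximum and the sum of `g`. -/
lemma le_max_add_sum_div (g : ι → ℝ) (hg : ∀ i, 0 ≤ g i) {a : ℕ} (ha : 0 < a)
    (F : Finset ι → ℝ) (hF : ∀ s t, Disjoint s t → F (s ∪ t) ≤ F s + F t) {C : ℝ} (hC : 0 ≤ C)
    (hFC : ∀ B M, #B ≤ a → 0 ≤ M → (∀ i ∈ B, g i ≤ M) → F B ≤ C * M)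
    (s : Finset ι) (M : ℝ) (hM : 0 ≤ M) (hs : ∀ i ∈ s, g i ≤ M) :
    F s ≤ C * (M + (∑ i ∈ s, g i) / a) := by
  induction s using Finset.strongInduction generalizing M with
  | H s ih =>
    have ha' : (0 : ℝ) < a := by exact_mod_cast ha
    rcases le_or_gt (#s) a with hsa | hsa
    · refine (hFC s M hsa hM hs).trans (mul_le_mul_of_nonneg_left ?_ hC)
      have : 0 ≤ (∑ i ∈ s, g i) / a := div_nonneg (Finset.sum_nonneg fun i _ => hg i) ha'.le
      linarith
    · obtain ⟨B, hBs, hBa, hB⟩ := exists_subset_card_eq_forall_le g s a hsa.le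
      have hBne : B.Nonempty := by
        rw [← Finset.card_pos]
        omega
      have h1 := hFC B M hBa.le hM fun i hi => hs i (hBs hi)
      have h2 := ih (s \ B) (Finset.sdiff_ssubset hBs hBne) ((∑ i ∈ B, g i) / a)
        (div_nonneg (Finset.sum_nonneg fun i _ => hg i) ha'.le)
        fun j hj => le_sum_div_of_forall_le g ha hBa fun i hi => hB i hi j hj
      have h3 := hF B (s \ B) Finset.disjoint_sdiff
      rw [Finset.union_sdiff_of_subset hBs] at h3
      have h4 := Finset.sum_sdiff (f := g) hBs
      have h5 : (∑ i ∈ B, g i) / a + (∑ i ∈ s \ B, g i) / a = (∑ i ∈ s, g i) / a := by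
        rw [← h4]
        ring
      rw [h5] at h2
      linarith

/-- After removing the `a` largest values of `g` on `s`, a subadditive set function controlled on
small sets by the maximum of `g` is controlled by the average of `g`. -/
lemma exists_card_le_forall_le_sum_div (g : ι → ℝ) (hg : ∀ i, 0 ≤ g i) {a : ℕ} (ha : 0 < a)
    (s : Finset ι) :
    ∃ B : Finset ι, #B ≤ a ∧ ∀ (F : Finset ι → ℝ) (C : ℝ),
      (∀ s t, Disjoint s t → F (s ∪ t) ≤ F s + F t) → 0 ≤ C →
      (∀ B M, #B ≤ a → 0 ≤ M → (∀ i ∈ B, g i ≤ M) → F B ≤ C * M) →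
      ∀ D ⊆ s, Disjoint D B → F D ≤ C * ((∑ i ∈ s, g i) / a) := by
  have ha' : (0 : ℝ) < a := by exact_mod_cast ha
  rcases le_or_gt (#s) a with hsa | hsa
  · refine ⟨s, hsa, fun F C _ hC hFC D hDs hD => ?_⟩
    have hD0 : D = ∅ := by
      rw [← Finset.disjoint_self_iff_empty]
      exact hD.mono_right hDs
    subst hD0
    refine hFC ∅ _ (by simp) (div_nonneg (Finset.sum_nonneg fun i _ => hg i) ha'.le) (by simp)
  · obtain ⟨B, hBs, hBa, hB⟩ := exists_subset_card_eq_forall_le g s a hsa.le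
    refine ⟨B, hBa.le, fun F C hF hC hFC D hDs hD => ?_⟩
    have hDsB : D ⊆ s \ B := Finset.subset_sdiff.2 ⟨hDs, hD⟩
    refine (le_max_add_sum_div g hg ha F hF hC hFC D ((∑ i ∈ B, g i) / a)
      (div_nonneg (Finset.sum_nonneg fun i _ => hg i) ha'.le) fun j hj =>
        le_sum_div_of_forall_le g ha hBa fun i hi => hB i hi j (hDsB hj)).trans
      (mul_le_mul_of_nonneg_left ?_ hC)
    rw [← add_div, ← Finset.sum_sdiff (f := g) hBs, add_comm]
    gcongr
    exact fun i _ _ => hg i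

end Blocks

section Norms

variable {ι : Type*} [Fintype ι] {𝕜 : Type*} [RCLike 𝕜]

lemma lpNorm_one_eq_sum (v : ι → 𝕜) : lpNorm 1 v = ∑ i, ‖v i‖ := by
  simp [_root_.lpNorm]

lemma lpNorm_two_eq_norm (v : ι → 𝕜) : lpNorm 2 v = ‖WithLp.toLp 2 v‖ := by
  simp [_root_.lpNorm, EuclideanSpace.norm_eq, Real.sqrt_eq_rpow]

lemma lpNorm_real_nonneg (q : ℝ) (v : ι → 𝕜) : 0 ≤ lpNorm q v :=
  Real.rpow_nonneg (Finset.sum_nonneg fun _ _ => Real.rpow_nonneg (norm_nonneg _) _) _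

lemma lpNorm_two_add_le (u v : ι → 𝕜) : lpNorm 2 (u + v) ≤ lpNorm 2 u + lpNorm 2 v := by
  simp only [lpNorm_two_eq_norm, WithLp.toLp_add]
  exact norm_add_le _ _

lemma lpNorm_two_mono {𝕜' : Type*} [RCLike 𝕜'] {u : ι → 𝕜} {v : ι → 𝕜'}
    (h : ∀ i, ‖u i‖ ≤ ‖v i‖) : lpNorm 2 u ≤ lpNorm 2 v := by
  unfold _root_.lpNorm
  gcongr with i
  exact h i

lemma lpNorm_two_sq (v : ι → 𝕜) : lpNorm 2 v ^ 2 = ∑ i, ‖v i‖ ^ 2 := by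
  rw [lpNorm_two_eq_norm, EuclideanSpace.norm_sq_eq]

lemma sum_norm_indicator (s : Finset ι) (v : ι → 𝕜) (q : ℕ) (hq : q ≠ 0) :
    ∑ i, ‖Set.indicator (s : Set ι) v i‖ ^ q = ∑ i ∈ s, ‖v i‖ ^ q := by
  classical
  rw [← Finset.sum_subset (Finset.subset_univ s)]
  · exact Finset.sum_congr rfl fun i hi => by simp [hi]
  · intro i _ hi
    simp [hi, hq]

lemma lpNorm_two_indicator_le (s : Finset ι) (v : ι → 𝕜) {a : ℕ} (hs : #s ≤ a) {M : ℝ}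
    (hM : 0 ≤ M) (hv : ∀ i ∈ s, ‖v i‖ ≤ M) :
    lpNorm 2 (Set.indicator (s : Set ι) v) ≤ √a * M := by
  refine le_of_sq_le_sq ?_ (by positivity)
  rw [lpNorm_two_sq, sum_norm_indicator s v 2 two_ne_zero, mul_pow, Real.sq_sqrt (by positivity)]
  calc ∑ i ∈ s, ‖v i‖ ^ 2 ≤ ∑ _i ∈ s, M ^ 2 := by
        gcongr with i hi
        exact hv i hi
    _ = #s * M ^ 2 := by simp
    _ ≤ a * M ^ 2 := by gcongr

lemma sum_norm_le_sqrt_mul_lpNorm_two (s : Finset ι) (v : ι → 𝕜) {k : ℕ} (hs : #s ≤ k)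
    {T : Finset ι} (hsT : s ⊆ T) :
    ∑ i ∈ s, ‖v i‖ ≤ √k * lpNorm 2 (Set.indicator (T : Set ι) v) := by
  refine le_of_sq_le_sq ?_ (mul_nonneg (by positivity) (lpNorm_real_nonneg _ _))
  rw [mul_pow, Real.sq_sqrt (by positivity), lpNorm_two_sq, sum_norm_indicator T v 2 two_ne_zero]
  calc (∑ i ∈ s, ‖v i‖) ^ 2 ≤ #s * ∑ i ∈ s, ‖v i‖ ^ 2 := sq_sum_le_card_mul_sum_sq
    _ ≤ k * ∑ i ∈ T, ‖v i‖ ^ 2 := by gcongr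

lemma l0Norm_indicator_le (s : Finset ι) (v : ι → 𝕜) :
    l0Norm (Set.indicator (s : Set ι) v) ≤ #s := by
  classical
  refine Finset.card_le_card fun i hi => ?_
  by_contra h
  simp [h] at hi

lemma phaseDist_le (q : ℝ) (x y : ι → 𝕜) {c : 𝕜} (hc : ‖c‖ = 1) :
    phaseDist q x y ≤ lpNorm q (fun i => x i - c * y i) :=
  csInf_le ⟨0, by rintro _ ⟨c, _, rfl⟩; exact lpNorm_real_nonneg _ _⟩ ⟨c, hc, rfl⟩

/-- The infimum defining the phase distance is attained. -/
lemma exists_phaseDist_two_eq (x y : ι → 𝕜) :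
    ∃ c : 𝕜, ‖c‖ = 1 ∧ lpNorm 2 (fun i => x i - c * y i) = phaseDist 2 x y := by
  have hcont : Continuous fun c : 𝕜 => lpNorm 2 (fun i => x i - c * y i) := by
    simp only [lpNorm_two_eq_norm, EuclideanSpace.norm_eq]
    fun_prop
  obtain ⟨c, hc, hmin⟩ := (isCompact_sphere (0 : 𝕜) 1).exists_isMinOn ⟨1, by simp⟩
    hcont.continuousOn
  have hc1 : ‖c‖ = 1 := by simpa using hc
  refine ⟨c, hc1, le_antisymm (le_csInf ⟨_, c, hc1, rfl⟩ ?_) (phaseDist_le _ _ _ hc1)⟩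
  rintro _ ⟨d, hd, rfl⟩
  exact hmin (by simpa using hd)

/-- The best `k`-term `ℓ₁`-error dominates the `ℓ₁`-norm off some set of at most `k` indices. -/
lemma exists_sum_compl_le_sigmaK [DecidableEq ι] (k : ℕ) (x : ι → 𝕜) :
    ∃ S : Finset ι, #S ≤ k ∧ ∑ i ∈ Sᶜ, ‖x i‖ ≤ sigmaK k 1 x := by
  obtain ⟨S, hS, hmin⟩ := Finset.exists_min_image
    (Finset.univ.filter fun S : Finset ι => #S ≤ k) (fun S => ∑ i ∈ Sᶜ, ‖x i‖) ⟨∅, by simp⟩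
  refine ⟨S, by simpa using hS, le_csInf ⟨_, 0, by simp [l0Norm], rfl⟩ ?_⟩
  rintro _ ⟨z, hz, rfl⟩
  classical
  have hz' : #(Finset.univ.filter fun i => z i ≠ 0) ≤ k := by
    rw [l0Norm] at hz
    convert hz
  refine (hmin (Finset.univ.filter fun i => z i ≠ 0) (by simpa using hz')).trans ?_
  rw [lpNorm_one_eq_sum]
  refine le_trans (Finset.sum_le_sum fun i hi => ?_)
    (Finset.sum_le_sum_of_subset_of_nonneg (Finset.subset_univ _) fun _ _ _ => norm_nonneg _)
  have : z i = 0 := by simpa using hi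
  simp [this]

end Norms

section Measurements

variable {m n : ℕ} {𝕜 : Type*} [RCLike 𝕜] (A : Fin m → Fin n → 𝕜)

lemma absMv_nonneg (v : Fin n → 𝕜) (i : Fin m) : 0 ≤ absMv A v i := norm_nonneg _

lemma absMv_add_le (u v : Fin n → 𝕜) (i : Fin m) :
    absMv A (u + v) i ≤ absMv A u i + absMv A v i := by
  simp only [absMv, Pi.add_apply, mul_add, Finset.sum_add_distrib]
  exact norm_add_le _ _

lemma lpNorm_absMv_add_le (u v : Fin n → 𝕜) :
    lpNorm 2 (absMv A (u + v)) ≤ lpNorm 2 (absMv A u) + lpNorm 2 (absMv A v) := by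
  refine le_trans (lpNorm_two_mono fun i => ?_) (lpNorm_two_add_le _ _)
  rw [Pi.add_apply, Real.norm_of_nonneg (absMv_nonneg A _ i), Real.norm_of_nonneg
    (add_nonneg (absMv_nonneg A _ i) (absMv_nonneg A _ i))]
  exact absMv_add_le A u v i

lemma abs_absMv_add_sub_le (u v : Fin n → 𝕜) (i : Fin m) :
    |absMv A (u + v) i - absMv A u i| ≤ absMv A v i := by
  simp only [absMv, Pi.add_apply, mul_add, Finset.sum_add_distrib]
  refine (abs_norm_sub_norm_le _ _).trans_eq ?_
  rw [add_sub_cancel_left]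

lemma lpNorm_absMv_sub_le (u v u' v' : Fin n → 𝕜) (e : Fin m → ℝ) :
    lpNorm 2 (fun i => absMv A u i - absMv A v i) ≤
      lpNorm 2 (fun i => absMv A (u + u') i - (absMv A (v + v') i + e i)) + lpNorm 2 e
        + (lpNorm 2 (absMv A u') + lpNorm 2 (absMv A v')) := by
  have h : (fun i => absMv A u i - absMv A v i) =
      ((fun i => absMv A (u + u') i - (absMv A (v + v') i + e i)) + e) +
        ((fun i => absMv A u i - absMv A (u + u') i) +
          fun i => absMv A (v + v') i - absMv A v i) := by
    ext i
    simp only [Pi.add_apply]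
    ring
  rw [h]
  refine (lpNorm_two_add_le _ _).trans (add_le_add (lpNorm_two_add_le _ _)
    ((lpNorm_two_add_le _ _).trans (add_le_add ?_ ?_)))
  · refine lpNorm_two_mono fun i => ?_
    rw [Real.norm_of_nonneg (absMv_nonneg A _ i), Real.norm_eq_abs, abs_sub_comm]
    exact abs_absMv_add_sub_le A u u' i
  · refine lpNorm_two_mono fun i => ?_
    rw [Real.norm_of_nonneg (absMv_nonneg A _ i), Real.norm_eq_abs]
    exact abs_absMv_add_sub_le A v v' i

variable {A}

lemma PhaselessBiLip.lpNorm_absMv_le {X : Set (Fin n → 𝕜)} {L U : ℝ} (hA : PhaselessBiLip A X L U)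
    (hU : 0 ≤ U) {v : Fin n → 𝕜} (hv : v ∈ X) (h0 : 0 ∈ X) :
    lpNorm 2 (absMv A v) ≤ U * lpNorm 2 v := by
  have h := (hA v hv 0 h0).2
  have h1 : (fun i => absMv A v i - absMv A 0 i) = absMv A v := by
    ext i
    simp [absMv]
  rw [h1] at h
  refine h.trans (mul_le_mul_of_nonneg_left ?_ hU)
  simpa using phaseDist_le 2 v 0 (c := (1 : 𝕜)) (by simp)

/-- Off a suitable set of at most `a` indices, the Euclidean norm of a vector and of its
measurements are controlled by an `ℓ₁`-norm divided by `√a`. -/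
lemma exists_card_le_forall_tail_le {a : ℕ} (ha : 0 < a) {U : ℝ} (hU : 0 ≤ U)
    (hA : ∀ v : Fin n → 𝕜, l0Norm v ≤ a → lpNorm 2 (absMv A v) ≤ U * lpNorm 2 v)
    (v : Fin n → 𝕜) (s : Finset (Fin n)) :
    ∃ B : Finset (Fin n), #B ≤ a ∧ ∀ D ⊆ s, Disjoint D B →
      lpNorm 2 (Set.indicator (D : Set (Fin n)) v) ≤ (∑ i ∈ s, ‖v i‖) / √a ∧
      lpNorm 2 (absMv A (Set.indicator (D : Set (Fin n)) v)) ≤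
        U * ((∑ i ∈ s, ‖v i‖) / √a) := by
  obtain ⟨B, hBa, hB⟩ := exists_card_le_forall_le_sum_div (fun i => ‖v i‖)
    (fun i => norm_nonneg _) ha s
  have hunion : ∀ s t : Finset (Fin n), Disjoint s t →
      Set.indicator ((s ∪ t : Finset (Fin n)) : Set (Fin n)) v =
        Set.indicator (s : Set (Fin n)) v + Set.indicator (t : Set (Fin n)) v := by
    intro s t hst
    rw [Finset.coe_union]
    exact Set.indicator_union_of_disjoint (Finset.disjoint_coe.2 hst) v
  have hsqrt : ∀ y : ℝ, √a * (y / a) = y / √a := by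
    intro y
    have h : √(a : ℝ) ^ 2 = a := Real.sq_sqrt (by positivity)
    have h0 : √(a : ℝ) ≠ 0 := by positivity
    nth_rewrite 2 [← h]
    field_simp
  refine ⟨B, hBa, fun D hDs hD => ⟨?_, ?_⟩⟩
  · have := hB (fun D => lpNorm 2 (Set.indicator (D : Set (Fin n)) v)) (√a)
      (fun s t hst => by
        simp only [hunion s t hst]
        exact lpNorm_two_add_le _ _)
      (by positivity) (fun B M hB hM hv => lpNorm_two_indicator_le B v hB hM hv) D hDs hD
    rwa [hsqrt] at this
  · have := hB (fun D => lpNorm 2 (absMv A (Set.indicator (D : Set (Fin n)) v))) (U * √a)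
      (fun s t hst => by
        simp only [hunion s t hst]
        exact lpNorm_absMv_add_le A _ _)
      (by positivity)
      (fun B M hB hM hv => by
        refine (hA _ ((l0Norm_indicator_le B v).trans hB)).trans ?_
        rw [mul_assoc]
        exact mul_le_mul_of_nonneg_left (lpNorm_two_indicator_le B v hB hM hv) hU) D hDs hD
    rwa [mul_assoc, hsqrt] at this

/-- Arithmetic passing from the recursive estimate for `H`, the phase distance of the restricted
vectors, to the final error bounds. Here `ρ = r ^ (-1/2)` and `K = √k`. -/
lemma error_bounds_of_restricted_bound {r L U K ρ t s σ η H d₁ d₂ : ℝ} (hr : 2 ≤ r) (hL : 0 < L)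
    (hU : 0 ≤ U) (hK : 0 < K) (hρ : 0 ≤ ρ) (hη : 0 ≤ η) (hH : 0 ≤ H) (hs : 0 ≤ s) (hsσ : s ≤ σ)
    (ht : t = 1 - U / L * (√2 * ρ)) (ht0 : 0 < t)
    (hLH : L * H ≤ 2 * η + U * (ρ * H + (ρ + 1) * (s / K)))
    (hd₁ : d₁ ≤ 2 * (K * H) + 2 * s) (hd₂ : d₂ ≤ H + (ρ * H + (ρ + 1) * (s / K))) :
    d₁ ≤ (2 * (U / L) * (ρ + 1) * √(2 + r) / t + 2) * σ + 1 / L * (2 * √(2 + r)) / t * K * η ∧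
    d₂ ≤ (U / L * (ρ + 1) * (1 + √2 * ρ) / t + ρ + 1) * σ / K
      + 1 / L * (2 * (1 + √2 * ρ)) / t * η := by
  have hσ : 0 ≤ σ := hs.trans hsσ
  have hq : 2 ≤ √(2 + r) := Real.le_sqrt_of_sq_le (by linarith)
  have h2 : 1 ≤ √(2 : ℝ) := Real.le_sqrt_of_sq_le (by norm_num)
  have hρ2 : ρ ≤ √2 * ρ := le_mul_of_one_le_left hρ h2
  have hw : s / K ≤ σ / K := by gcongr
  have hu : 0 ≤ U / L := by positivity
  have hHX : H ≤ (1 / L * (2 * η) + U / L * ((ρ + 1) * (σ / K))) / t := by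
    rw [le_div_iff₀ ht0]
    have h3 : H ≤ 1 / L * (2 * η) + U / L * (ρ * H + (ρ + 1) * (s / K)) := by
      have : 1 / L * (2 * η) + U / L * (ρ * H + (ρ + 1) * (s / K)) =
          (2 * η + U * (ρ * H + (ρ + 1) * (s / K))) / L := by ring
      rw [this, le_div_iff₀ hL]
      linarith
    have h4 : U / L * (ρ * H + (ρ + 1) * (s / K)) ≤
        U / L * (√2 * ρ * H + (ρ + 1) * (σ / K)) := by gcongr
    rw [ht]
    linarith
  set X := (1 / L * (2 * η) + U / L * ((ρ + 1) * (σ / K))) / t with hX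
  constructor
  · have h3 : 2 * (K * H) ≤ 2 * (K * X) := by gcongr
    have h4 : 2 * (K * X) = U / L * (ρ + 1) / t * σ * 2 + 1 / L / t * K * η * 2 * 2 := by
      rw [hX]
      field_simp
      ring
    have h5 : U / L * (ρ + 1) / t * σ * 2 ≤ U / L * (ρ + 1) / t * σ * 2 * √(2 + r) :=
      le_mul_of_one_le_right (by positivity) (by linarith)
    have h6 : 1 / L / t * K * η * 2 * 2 ≤ 1 / L / t * K * η * 2 * √(2 + r) := by gcongr
    calc d₁ ≤ U / L * (ρ + 1) / t * σ * 2 * √(2 + r) + 1 / L / t * K * η * 2 * √(2 + r) + 2 * σ := by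
          linarith
      _ = _ := by ring
  · have h3 : ρ * H ≤ √2 * ρ * H := by gcongr
    have h4 : (1 + √2 * ρ) * H ≤ (1 + √2 * ρ) * X := by gcongr
    have h5 : (ρ + 1) * (s / K) ≤ (ρ + 1) * (σ / K) := by gcongr
    calc d₂ ≤ (1 + √2 * ρ) * X + (ρ + 1) * (σ / K) := by linarith
      _ = _ := by
        rw [hX]
        ring

end Measurements

/-- Corollary `th: main`: the `ℓ₁` case. Under the phaseless bi-Lipschitz
condition on `(r+4)k`-sparse vectors with `r > 2(U/L)²`, any feasible `ℓ₁`-minimizer `x♯`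
satisfies `dist₁(x♯,x) ≤ C₁·σ_k(x)₁ + D₁·√k·η` and `dist(x♯,x) ≤ C₂·σ_k(x)₁/√k + D₂·η`. -/
theorem stmt2 {𝕜 : Type*} [RCLike 𝕜] (k m n : ℕ) (hk : 0 < k) (hm : 0 < m) (hn : 0 < n)
    (hkn : k ≤ n)
    (r L U : ℝ) (hr : 0 < r) (hL : 0 < L) (hLU : L ≤ U)
    (hrUL : 2 * (U / L) ^ 2 < r)
    (A : Fin m → Fin n → 𝕜)
    (hA : PhaselessBiLip A {z | (l0Norm z : ℝ) ≤ (r + 4) * k} L U)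
    (t C₁ D₁ C₂ D₂ : ℝ)
    (ht : t = 1 - (U / L) * (2 / r) ^ ((1 : ℝ) / 2))
    (hC₁ : C₁ = 2 * (U / L) * (r ^ (-(1 : ℝ) / 2) + 1) * (2 + r) ^ ((1 : ℝ) / 2) / t + 2)
    (hD₁ : D₁ = (1 / L) * (2 * (2 + r) ^ ((1 : ℝ) / 2)) / t)
    (hC₂ : C₂ = (U / L) * (r ^ (-(1 : ℝ) / 2) + 1) * (1 + (r / 2) ^ (-(1 : ℝ) / 2)) / t
        + r ^ (-(1 : ℝ) / 2) + 1)
    (hD₂ : D₂ = (1 / L) * (2 * (1 + (r / 2) ^ (-(1 : ℝ) / 2))) / t)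
    (x xs : Fin n → 𝕜) (η : ℝ) (hη : 0 ≤ η) (e : Fin m → ℝ) (he : lpNorm 2 e ≤ η)
    (hfeas : lpNorm 2 (fun i => absMv A xs i - (absMv A x i + e i)) ≤ η)
    (hmin : lpNorm 1 xs ≤ lpNorm 1 x) :
    phaseDist 1 xs x ≤ C₁ * sigmaK k 1 x + D₁ * Real.sqrt k * η ∧
    phaseDist 2 xs x ≤ C₂ * sigmaK k 1 x / Real.sqrt k + D₂ * η := by
  classical
  have hU : 0 < U := hL.trans_le hLU
  have hk1 : (1 : ℝ) ≤ k := by exact_mod_cast hk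
  have hk0 : (0 : ℝ) < k := by linarith
  have hUL : 1 ≤ U / L := (one_le_div hL).2 hLU
  have hr2 : 2 ≤ r := by nlinarith
  obtain ⟨S, hSk, hSσ⟩ := exists_sum_compl_le_sigmaK k x
  set a := ⌈r * k⌉₊ with ha_def
  have har : r * k ≤ a := Nat.le_ceil _
  have har' : (a : ℝ) ≤ r * k + 1 := (Nat.ceil_lt_add_one (by positivity)).le
  have ha : 0 < a := Nat.ceil_pos.2 (by positivity)
  have hsub : ∀ v : Fin n → 𝕜, (l0Norm v : ℝ) ≤ (r + 4) * k →
      lpNorm 2 (absMv A v) ≤ U * lpNorm 2 v := fun v hv =>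
    hA.lpNorm_absMv_le hU.le hv (by simp only [Set.mem_ofPred_eq, l0Norm]; simp; positivity)
  obtain ⟨B₁, hB₁k, hB₁⟩ := exists_card_le_forall_tail_le hk hU.le (fun v hv => hsub v (by
    have : (l0Norm v : ℝ) ≤ k := by exact_mod_cast hv
    nlinarith)) x Sᶜ
  obtain ⟨B₂, hB₂a, hB₂⟩ := exists_card_le_forall_tail_le ha hU.le (fun v hv => hsub v (by
    have : (l0Norm v : ℝ) ≤ a := by exact_mod_cast hv
    nlinarith)) xs Sᶜ
  set T := S ∪ B₁ ∪ B₂ with hT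
  have hTcard : ∀ v : Fin n → 𝕜,
      (l0Norm (Set.indicator (T : Set (Fin n)) v) : ℝ) ≤ (r + 4) * k := by
    intro v
    have h1 := l0Norm_indicator_le T v
    have h2 : #T ≤ #S + #B₁ + #B₂ :=
      (Finset.card_union_le _ _).trans (Nat.add_le_add_right (Finset.card_union_le _ _) _)
    have h3 : (l0Norm (Set.indicator (T : Set (Fin n)) v) : ℝ) ≤ k + k + a := by
      exact_mod_cast h1.trans (h2.trans (by omega))
    nlinarith
  have hST : S ⊆ T := fun i hi => by simp [hT, hi]
  have hDS : Tᶜ ⊆ Sᶜ := Finset.compl_subset_compl.2 hST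
  obtain ⟨hx₂, hxA⟩ := hB₁ Tᶜ hDS (Finset.disjoint_left.2 fun i hi hi' => by simp [hT, hi'] at hi)
  obtain ⟨hxs₂, hxsA⟩ := hB₂ Tᶜ hDS
    (Finset.disjoint_left.2 fun i hi hi' => by simp [hT, hi'] at hi)
  have hsplit : ∀ v : Fin n → 𝕜, Set.indicator (T : Set (Fin n)) v
      + Set.indicator ((Tᶜ : Finset (Fin n)) : Set (Fin n)) v = v := fun v => by
    rw [Finset.coe_compl]
    exact Set.indicator_self_add_compl _ _
  obtain ⟨c, hc, hcH⟩ := exists_phaseDist_two_eq (Set.indicator (T : Set (Fin n)) xs)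
    (Set.indicator (T : Set (Fin n)) x)
  have hcT : (fun i => Set.indicator (T : Set (Fin n)) xs i
      - c * Set.indicator (T : Set (Fin n)) x i) =
      Set.indicator (T : Set (Fin n)) (fun i => xs i - c * x i) := by
    ext i
    by_cases hi : i ∈ T <;> simp [hi]
  have hLH := (hA _ (hTcard xs) _ (hTcard x)).1.trans (lpNorm_absMv_sub_le A _ _
    (Set.indicator ((Tᶜ : Finset (Fin n)) : Set (Fin n)) xs)
    (Set.indicator ((Tᶜ : Finset (Fin n)) : Set (Fin n)) x) e)
  rw [hsplit, hsplit] at hLH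
  set H := phaseDist 2 (Set.indicator (T : Set (Fin n)) xs) (Set.indicator (T : Set (Fin n)) x)
    with hH_def
  rw [hcT] at hcH
  have hH : 0 ≤ H := hcH ▸ lpNorm_real_nonneg _ _
  have hSH := sum_norm_le_sqrt_mul_lpNorm_two S (fun i => xs i - c * x i) hSk hST
  rw [hcH] at hSH
  have hcx : ∀ i, ‖c * x i‖ = ‖x i‖ := fun i => by rw [norm_mul, hc, one_mul]
  set s := ∑ i ∈ Sᶜ, ‖x i‖ with hs_def
  have hs0 : 0 ≤ s := Finset.sum_nonneg fun i _ => norm_nonneg _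
  have hcone : ∑ i ∈ Sᶜ, ‖xs i‖ ≤ √k * H + s := by
    rw [lpNorm_one_eq_sum, lpNorm_one_eq_sum, ← Finset.sum_add_sum_compl S,
      ← Finset.sum_add_sum_compl S (fun i => ‖x i‖)] at hmin
    have h1 : ∑ i ∈ S, ‖x i‖ ≤ ∑ i ∈ S, ‖xs i - c * x i‖ + ∑ i ∈ S, ‖xs i‖ := by
      rw [← Finset.sum_add_distrib]
      refine Finset.sum_le_sum fun i _ => ?_
      rw [← hcx i, norm_sub_rev]
      exact norm_le_norm_sub_add _ _
    linarith
  have hK : 0 < √(k : ℝ) := Real.sqrt_pos.2 hk0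
  set ρ := r ^ (-(1 : ℝ) / 2) with hρ_def
  have hρ : 0 ≤ ρ := by positivity
  have hρ_sqrt : ρ = (√r)⁻¹ := by
    rw [hρ_def, neg_div, Real.rpow_neg hr.le, Real.sqrt_eq_rpow]
  have htail : (∑ i ∈ Sᶜ, ‖xs i‖) / √a + s / √k ≤ ρ * H + (ρ + 1) * (s / √k) := by
    have h1 : (∑ i ∈ Sᶜ, ‖xs i‖) / √a ≤ (√k * H + s) / (√r * √k) := by
      rw [← Real.sqrt_mul hr.le]
      gcongr
    have h2 : (√k * H + s) / (√r * √k) = ρ * H + ρ * (s / √k) := by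
      rw [hρ_sqrt]
      have : √r ≠ 0 := (Real.sqrt_pos.2 hr).ne'
      field_simp
    linarith
  have hLH' : L * H ≤ 2 * η + U * (ρ * H + (ρ + 1) * (s / √k)) := by
    have := mul_le_mul_of_nonneg_left htail hU.le
    linarith
  have hd₁ : phaseDist 1 xs x ≤ 2 * (√k * H) + 2 * s := by
    refine (phaseDist_le 1 xs x hc).trans ?_
    rw [lpNorm_one_eq_sum, ← Finset.sum_add_sum_compl S]
    have h1 : ∑ i ∈ Sᶜ, ‖xs i - c * x i‖ ≤ ∑ i ∈ Sᶜ, ‖xs i‖ + s := by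
      rw [hs_def, ← Finset.sum_add_distrib]
      refine Finset.sum_le_sum fun i _ => ?_
      rw [← hcx i]
      exact norm_sub_le _ _
    linarith
  have hd₂ : phaseDist 2 xs x ≤ H + (ρ * H + (ρ + 1) * (s / √k)) := by
    refine (phaseDist_le 2 xs x hc).trans ?_
    have h1 : (fun i => xs i - c * x i) = Set.indicator (T : Set (Fin n)) (fun i => xs i - c * x i)
        + (Set.indicator ((Tᶜ : Finset (Fin n)) : Set (Fin n)) xs
          + fun i => -(c * Set.indicator ((Tᶜ : Finset (Fin n)) : Set (Fin n)) x i)) := by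
      ext i
      by_cases hi : i ∈ T <;> simp [hi, sub_eq_add_neg]
    have h2 : lpNorm 2 (fun i => -(c * Set.indicator ((Tᶜ : Finset (Fin n)) : Set (Fin n)) x i)) ≤
        lpNorm 2 (Set.indicator ((Tᶜ : Finset (Fin n)) : Set (Fin n)) x) :=
      lpNorm_two_mono fun i => by rw [norm_neg, norm_mul, hc, one_mul]
    have h3 := lpNorm_two_add_le (Set.indicator (T : Set (Fin n)) (fun i => xs i - c * x i))
      (Set.indicator ((Tᶜ : Finset (Fin n)) : Set (Fin n)) xs
          + fun i => -(c * Set.indicator ((Tᶜ : Finset (Fin n)) : Set (Fin n)) x i))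
    have h4 := lpNorm_two_add_le (Set.indicator ((Tᶜ : Finset (Fin n)) : Set (Fin n)) xs)
      (fun i => -(c * Set.indicator ((Tᶜ : Finset (Fin n)) : Set (Fin n)) x i))
    rw [← h1] at h3
    linarith
  have hq₁ : (2 / r) ^ ((1 : ℝ) / 2) = √2 * ρ := by
    rw [← Real.sqrt_eq_rpow, Real.sqrt_div zero_le_two, hρ_sqrt, div_eq_mul_inv]
  have hq₂ : (r / 2) ^ (-(1 : ℝ) / 2) = √2 * ρ := by
    rw [← hq₁, neg_div, Real.rpow_neg (by positivity), ← Real.inv_rpow (by positivity), inv_div]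
  have ht0 : 0 < t := by
    rw [ht, ← Real.sqrt_eq_rpow, sub_pos]
    refine lt_of_pow_lt_pow_left₀ 2 zero_le_one ?_
    rw [mul_pow, Real.sq_sqrt (by positivity), one_pow, mul_div_assoc', div_lt_one hr]
    linarith
  rw [hq₁] at ht
  rw [hq₂] at hC₂ hD₂
  rw [← Real.sqrt_eq_rpow] at hC₁ hD₁
  rw [hC₁, hC₂, hD₁, hD₂]
  exact error_bounds_of_restricted_bound hr2 hL hU.le hK hρ hη hH hs0 hSσ ht ht0 hLH' hd₁ hd₂
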